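/- Under the rigid body director equations of motion (φ̇ = v_φ; ḋᵢ = v_{dᵢ}; m v̇_φ = −∇V(φ) + f_φ; Eᵢ v̇_{dᵢ} = −(constraint force on dᵢ) + fᵢ, with constraint forces λ₁d₁+λ₄d₂+λ₅d₃, λ₄d₁+λ₂d₂+λ₆d₃, λ₅d₁+λ₆d₂+λ₃d₃ respectively), suppose f_φ ≡ 0 and fᵢ ≡ 0 for i = 1,2,3, and let L := φ × m v_φ + Σᵢ dᵢ × Eᵢ v_{dᵢ}. Then: (a) if V is constant (∇V ≡ 0), L(t) is constant; (b) if V(φ) = m g ⟨φ, e₃⟩ for a constant g ∈ ℝ (uniform gravity along e₃), then the component ⟨L(t), e₃⟩ is constant. -/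

import Mathlib

open Matrix

noncomputable section

/-- Gradient (as a column vector) of a scalar function on `ℝⁿ`. -/
def grad {n : ℕ} (f : (Fin n → ℝ) → ℝ) (x : Fin n → ℝ) : Fin n → ℝ :=
  fun i => fderiv ℝ f x (Pi.single i 1)

theorem HasDerivAt.crossProduct {u v : ℝ → Fin 3 → ℝ} {u' v' : Fin 3 → ℝ} {t : ℝ}
    (hu : HasDerivAt u u' t) (hv : HasDerivAt v v' t) :
    HasDerivAt (fun s => crossProduct (u s) (v s))
      (crossProduct u' (v t) + crossProduct (u t) v') t := by
  rw [hasDerivAt_pi] at hu hv ⊢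
  intro i
  fin_cases i
  · refine (((hu 1).mul (hv 2)).sub ((hu 2).mul (hv 1))).congr_deriv ?_
    simp [cross_apply]
    ring
  · refine (((hu 2).mul (hv 0)).sub ((hu 0).mul (hv 2))).congr_deriv ?_
    simp [cross_apply]
    ring
  · refine (((hu 0).mul (hv 1)).sub ((hu 1).mul (hv 0))).congr_deriv ?_
    simp [cross_apply]
    ring

/-- The moment of momentum of a mass `c` changes at the rate of the moment of the force. -/
theorem hasDerivAt_crossProduct_smul_velocity {x v : ℝ → Fin 3 → ℝ} {F : Fin 3 → ℝ} {c t : ℝ}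
    (hx : DifferentiableAt ℝ x t) (hv : DifferentiableAt ℝ v t)
    (hxv : deriv x t = v t) (hF : c • deriv v t = F) :
    HasDerivAt (fun s => crossProduct (x s) (c • v s)) (crossProduct (x t) F) t := by
  have h := hx.hasDerivAt.crossProduct (hv.hasDerivAt.const_smul c)
  rw [hxv, hF] at h
  simpa [cross_self] using h

/-- A symmetric matrix of constraint forces exerts no total moment on the directors. -/
theorem crossProduct_symmetric_forces_sum_eq_zero (d1 d2 d3 : Fin 3 → ℝ) (l : Fin 6 → ℝ) :
    crossProduct d1 (-(l 0 • d1 + l 3 • d2 + l 4 • d3)) +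
      crossProduct d2 (-(l 3 • d1 + l 1 • d2 + l 5 • d3)) +
      crossProduct d3 (-(l 4 • d1 + l 5 • d2 + l 2 • d3)) = 0 := by
  ext i
  fin_cases i <;> simp [cross_apply] <;> ring

theorem grad_const_mul_dotProduct {n : ℕ} (c : ℝ) (e x : Fin n → ℝ) :
    grad (fun y => c * (y ⬝ᵥ e)) x = c • e := by
  ext i
  have h : HasFDerivAt (fun y : Fin n → ℝ => c * (y ⬝ᵥ e))
      (c • ∑ j, e j • ContinuousLinearMap.proj (R := ℝ) (φ := fun _ : Fin n => ℝ) j) x := by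
    refine HasFDerivAt.const_mul (HasFDerivAt.fun_sum fun j _ => ?_) c
    exact (hasFDerivAt_apply j x).mul_const (e j)
  simp [grad, h.fderiv, Pi.single_apply]

/-- Conservation of angular momentum for the free rigid body in director
formulation: (a) with constant potential the total angular momentum is
conserved; (b) with uniform gravity along `e₃` its third component is
conserved. -/
theorem director_angular_momentum_conservation
    (m E1 E2 E3 : ℝ) (hm : 0 < m) (hE1 : 0 < E1) (hE2 : 0 < E2) (hE3 : 0 < E3)
    (V : (Fin 3 → ℝ) → ℝ)
    (φ d1 d2 d3 vφ vd1 vd2 vd3 : ℝ → Fin 3 → ℝ)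
    (hφ : Differentiable ℝ φ)
    (hd1 : Differentiable ℝ d1) (hd2 : Differentiable ℝ d2) (hd3 : Differentiable ℝ d3)
    (hvφ : Differentiable ℝ vφ)
    (hvd1 : Differentiable ℝ vd1) (hvd2 : Differentiable ℝ vd2) (hvd3 : Differentiable ℝ vd3)
    (lam : ℝ → Fin 6 → ℝ) (fφ f1 f2 f3 : ℝ → Fin 3 → ℝ)
    (hfφ : ∀ t, fφ t = 0) (hf1 : ∀ t, f1 t = 0) (hf2 : ∀ t, f2 t = 0) (hf3 : ∀ t, f3 t = 0)
    (h1 : ∀ t, deriv φ t = vφ t)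
    (h2 : ∀ t, deriv d1 t = vd1 t)
    (h3 : ∀ t, deriv d2 t = vd2 t)
    (h4 : ∀ t, deriv d3 t = vd3 t)
    (h5 : ∀ t, m • deriv vφ t = -grad V (φ t) + fφ t)
    (h6 : ∀ t, E1 • deriv vd1 t =
        -(lam t 0 • d1 t + lam t 3 • d2 t + lam t 4 • d3 t) + f1 t)
    (h7 : ∀ t, E2 • deriv vd2 t =
        -(lam t 3 • d1 t + lam t 1 • d2 t + lam t 5 • d3 t) + f2 t)
    (h8 : ∀ t, E3 • deriv vd3 t =
        -(lam t 4 • d1 t + lam t 5 • d2 t + lam t 2 • d3 t) + f3 t)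
    (L : ℝ → Fin 3 → ℝ)
    (hL : ∀ t, L t = crossProduct (φ t) (m • vφ t) + crossProduct (d1 t) (E1 • vd1 t)
        + crossProduct (d2 t) (E2 • vd2 t) + crossProduct (d3 t) (E3 • vd3 t)) :
    ((∀ x, grad V x = 0) → ∀ s t, L s = L t) ∧
    (∀ gconst : ℝ,
      (V = fun x => m * gconst * (x ⬝ᵥ (Pi.single (2 : Fin 3) (1 : ℝ)))) →
      ∀ s t, L s ⬝ᵥ (Pi.single (2 : Fin 3) (1 : ℝ))
        = L t ⬝ᵥ (Pi.single (2 : Fin 3) (1 : ℝ))) := by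
  have hL' : ∀ t, HasDerivAt L (crossProduct (φ t) (-grad V (φ t))) t := by
    intro t
    have hmom := (((hasDerivAt_crossProduct_smul_velocity (hφ t) (hvφ t) (h1 t) (h5 t)).add
      (hasDerivAt_crossProduct_smul_velocity (hd1 t) (hvd1 t) (h2 t) (h6 t))).add
      (hasDerivAt_crossProduct_smul_velocity (hd2 t) (hvd2 t) (h3 t) (h7 t))).add
      (hasDerivAt_crossProduct_smul_velocity (hd3 t) (hvd3 t) (h4 t) (h8 t))
    rw [hfφ, hf1, hf2, hf3, add_zero, add_zero, add_zero, add_zero] at hmom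
    rw [funext hL]
    refine hmom.congr_deriv ?_
    rw [add_assoc, add_assoc, ← add_assoc (crossProduct (d1 t) _),
      crossProduct_symmetric_forces_sum_eq_zero, add_zero]
  refine ⟨fun hV s t => ?_, fun g hV s t => ?_⟩
  · refine is_const_of_deriv_eq_zero (fun r => (hL' r).differentiableAt) (fun r => ?_) s t
    rw [(hL' r).deriv, hV, neg_zero, map_zero]
  · have hL2 : ∀ r, HasDerivAt (fun r => L r 2) 0 r := by
      intro r
      refine (hasDerivAt_pi.1 (hL' r) 2).congr_deriv ?_
      rw [hV, grad_const_mul_dotProduct]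
      simp [cross_apply]
    simpa using is_const_of_deriv_eq_zero (fun r => (hL2 r).differentiableAt)
      (fun r => (hL2 r).deriv) s t

end
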